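/- Let n ≥ 3 and m ≥ 1 be integers and let α be a real with 0 < α ≤ 1 and m ≥ ⌈1/α⌉. Suppose there exist v, v' ∈ V(α;m) with MMS_n(v) > (4/3)·MMS_n(v'). Then: if n = 3 then 2/9 < α < 1/3; if n = 4 then 1/6 < α < 3/11; if n = 5 then either 4/45 < α < 1/9 or 2/15 < α < 3/13; and if n ≥ 6 then 4/(9n) < α < 3/(2n+3). -/

import Mathlib

open Finset

/-- A (normalised, additive) disutility function on `m` objects. -/
def IsDisutility (m : ℕ) (v : Fin m → ℝ) : Prop :=
  (∀ e, 0 ≤ v e) ∧ ∑ e, v e = 1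

/-- The MinMaxShare of `v` among `n` agents: the minimum over allocations
`A : Fin m → Fin n` of the maximum bundle disutility. -/
noncomputable def MMS (n m : ℕ) (v : Fin m → ℝ) : ℝ :=
  ⨅ A : Fin m → Fin n, ⨆ j : Fin n, ∑ e ∈ Finset.univ.filter (fun e => A e = j), v e

/-- `v ∈ V(α;m)`: a disutility function on `m` objects whose maximum single-object
value equals `α`. -/
def Vmem (α : ℝ) (m : ℕ) (v : Fin m → ℝ) : Prop :=
  IsDisutility m v ∧ (⨆ e, v e) = α

/-- Total weight of the objects of `S` that `A` gives to `j`. -/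
def load {ι κ M : Type*} [DecidableEq κ] [AddCommMonoid M] (w : ι → M) (S : Finset ι)
    (A : ι → κ) (j : κ) : M :=
  ∑ e ∈ S with A e = j, w e

theorem sum_load {ι κ M : Type*} [DecidableEq κ] [Fintype κ] [AddCommMonoid M] (w : ι → M)
    (S : Finset ι) (A : ι → κ) : ∑ j, load w S A j = ∑ e ∈ S, w e :=
  Finset.sum_fiberwise S A w

/-- Greedy extension of an allocation of `S` to an allocation of `S ∪ U`, with all loads kept
below `T`. -/
theorem exists_greedy_extension {ι κ M : Type*} [DecidableEq ι] [DecidableEq κ] [Fintype κ]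
    [AddCommMonoid M] [PartialOrder M] [IsOrderedAddMonoid M]
    (w : ι → M) (hw : ∀ e, 0 ≤ w e) (S : Finset ι) (A : ι → κ) (T : M)
    (hA : ∀ j, load w S A j ≤ T) (U : Finset ι) (hSU : Disjoint S U)
    (h : ∀ e ∈ U, ∀ f : κ → M, (∀ j, load w S A j ≤ f j) →
      ∑ j, f j + w e ≤ ∑ x ∈ S ∪ U, w x → ∃ j, f j + w e ≤ T) :
    ∃ B : ι → κ, (∀ j, load w S A j ≤ load w (S ∪ U) B j) ∧ ∀ j, load w (S ∪ U) B j ≤ T := by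
  induction U using Finset.induction_on with
  | empty => exact ⟨A, by simp, by simpa using hA⟩
  | insert a U ha ih =>
    rw [Finset.disjoint_insert_right] at hSU
    have haSU : a ∉ S ∪ U := by simp [hSU.1, ha]
    have hsum : ∑ x ∈ S ∪ insert a U, w x = ∑ x ∈ S ∪ U, w x + w a := by
      rw [Finset.union_insert, Finset.sum_insert haSU, add_comm]
    obtain ⟨B, hB, hBT⟩ := ih hSU.2 fun e he f hf hs =>
      h e (Finset.mem_insert_of_mem he) f hf
        (hs.trans (by rw [hsum]; exact le_add_of_nonneg_right (hw a)))
    obtain ⟨j, hj⟩ := h a (Finset.mem_insert_self a U) (load w (S ∪ U) B) hB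
      (by rw [sum_load, hsum])
    have hload : ∀ i, load w (S ∪ insert a U) (Function.update B a j) i
        = (if j = i then w a else 0) + load w (S ∪ U) B i := by
      intro i
      have hsame : ∑ e ∈ S ∪ U with Function.update B a j e = i, w e = load w (S ∪ U) B i := by
        unfold load
        congr 1
        refine Finset.filter_congr fun e he => ?_
        rw [Function.update_of_ne (ne_of_mem_of_not_mem he haSU)]
      unfold load at hsame ⊢
      rw [Finset.union_insert, Finset.filter_insert, Function.update_self]
      split_ifs with hji
      · rw [Finset.sum_insert (by simp [haSU]), hsame]
      · rw [hsame, zero_add]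
    refine ⟨Function.update B a j, fun i => ?_, fun i => ?_⟩ <;> rw [hload i]
    · refine (hB i).trans (le_add_of_nonneg_left ?_)
      split_ifs
      exacts [hw a, le_rfl]
    · split_ifs with hji
      · rw [← hji, add_comm]; exact hj
      · rw [zero_add]; exact hBT i

theorem exists_allocation_card_le {ι κ : Type*} [DecidableEq ι] [DecidableEq κ] [Fintype κ]
    [Nonempty κ] (S : Finset ι) (k : ℕ) (hS : S.card ≤ k * Fintype.card κ) :
    ∃ A : ι → κ, ∀ j, (S.filter (fun e => A e = j)).card ≤ k := by
  obtain ⟨B, -, hB⟩ := exists_greedy_extension (κ := κ) (fun _ : ι => 1) (fun _ => zero_le_one) ∅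
    (fun _ => Classical.arbitrary κ) k (by simp [load]) S (by simp) (by
      intro e _ f _ hs
      by_contra! hf
      have : ∑ _j : κ, k ≤ ∑ j, f j := Finset.sum_le_sum fun j _ => by have := hf j; omega
      simp at this hs
      rw [mul_comm] at hS
      omega)
  exact ⟨B, fun j => by simpa [load] using hB j⟩

theorem exists_allocation_load_le {ι κ : Type*} [DecidableEq ι] [DecidableEq κ] [Fintype κ]
    [Nonempty κ] (v : ι → ℝ) (α : ℝ) (hα : 0 ≤ α) (hv : ∀ e, v e ≤ α) (S : Finset ι) (k : ℕ)
    (hS : S.card ≤ k * Fintype.card κ) :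
    ∃ A : ι → κ, ∀ j, load v S A j ≤ k * α := by
  obtain ⟨A, hA⟩ := exists_allocation_card_le (κ := κ) S k hS
  refine ⟨A, fun j => ?_⟩
  have h1 := Finset.sum_le_card_nsmul (S.filter (fun e => A e = j)) v α fun e _ => hv e
  rw [nsmul_eq_mul] at h1
  exact h1.trans (mul_le_mul_of_nonneg_right (by exact_mod_cast hA j) hα)

theorem MMS_le_of_load_le {n m : ℕ} [NeZero n] {v : Fin m → ℝ} {T : ℝ} (A : Fin m → Fin n)
    (hA : ∀ j, load v univ A j ≤ T) : MMS n m v ≤ T :=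
  (ciInf_le (Set.finite_range _).bddBelow A).trans (ciSup_le hA)

theorem le_MMS_of_mem {n m : ℕ} [NeZero n] {v : Fin m → ℝ} (hv : ∀ e, 0 ≤ v e) (e : Fin m) :
    v e ≤ MMS n m v := by
  refine le_ciInf fun A => ?_
  refine le_trans ?_ (le_ciSup (Set.finite_range _).bddAbove (A e))
  exact Finset.single_le_sum (f := v) (fun x _ => hv x) (by simp)

theorem one_div_le_MMS {n m : ℕ} [NeZero n] {v : Fin m → ℝ} (hv : ∑ e, v e = 1) :
    1 / (n : ℝ) ≤ MMS n m v := by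
  have hn : (0 : ℝ) < n := by exact_mod_cast NeZero.pos n
  refine le_ciInf fun A => ?_
  rw [div_le_iff₀' hn, ← hv, ← sum_load v univ A]
  have h1 := Finset.sum_le_card_nsmul univ (load v univ A)
    (⨆ j, ∑ e with A e = j, v e)
    fun j _ => le_ciSup (f := load v univ A) (Set.finite_range _).bddAbove j
  simpa using h1

theorem Vmem.le {α : ℝ} {m : ℕ} {v : Fin m → ℝ} (h : Vmem α m v) (e : Fin m) : v e ≤ α :=
  h.2 ▸ le_ciSup (Set.finite_range v).bddAbove e

theorem Vmem.exists_eq {α : ℝ} {m : ℕ} (hm : 1 ≤ m) {v : Fin m → ℝ} (h : Vmem α m v) :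
    ∃ e, v e = α := by
  have : Nonempty (Fin m) := ⟨⟨0, hm⟩⟩
  obtain ⟨e, he⟩ := exists_eq_ciSup_of_finite (f := v)
  exact ⟨e, he.trans h.2⟩

theorem MMS_le_of_partial {n m : ℕ} [NeZero n] {v : Fin m → ℝ} (hv : IsDisutility m v) (T : ℝ)
    (S : Finset (Fin m)) (A : Fin m → Fin n) (hA : ∀ j, load v S A j ≤ T)
    (h : ∀ e ∉ S, ∀ f : Fin n → ℝ, (∀ j, load v S A j ≤ f j) →
      ∑ j, f j + v e ≤ 1 → ∃ j, f j + v e ≤ T) :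
    MMS n m v ≤ T := by
  obtain ⟨B, -, hB⟩ := exists_greedy_extension v hv.1 S A T hA Sᶜ disjoint_compl_right
    (fun e he f hf hs => h e (Finset.mem_compl.1 he) f hf
      (by rwa [Finset.union_compl, hv.2] at hs))
  rw [Finset.union_compl] at hB
  exact MMS_le_of_load_le B hB

theorem MMS_le_of_large {n m : ℕ} (hn : 3 ≤ n) {α : ℝ} (hα : 0 < α) (hm : 1 ≤ m)
    {v : Fin m → ℝ} (hv : Vmem α m v) (h : 3 / (2 * (n : ℝ) + 3) ≤ α) :
    MMS n m v ≤ 4 / 3 * α := by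
  have : NeZero n := ⟨by omega⟩
  have hn' : (3 : ℝ) ≤ n := by exact_mod_cast hn
  rw [div_le_iff₀ (by positivity)] at h
  obtain ⟨e₀, he₀⟩ := hv.exists_eq hm
  set S : Finset (Fin m) := univ.filter (fun e => 2 / 3 * α < v e) with hS
  have he₀S : e₀ ∈ S := by simp [hS, he₀]; linarith
  have hcard : S.card ≤ n := by
    by_contra! hc
    have h1 : (n : ℝ) ≤ (S.erase e₀).card := by
      rw [Finset.card_erase_of_mem he₀S]; exact_mod_cast (by omega)
    have hne : (S.erase e₀).Nonempty := by
      rw [← Finset.card_pos, Finset.card_erase_of_mem he₀S]; omega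
    have h2 : ∑ _e ∈ S.erase e₀, 2 / 3 * α < ∑ e ∈ S.erase e₀, v e :=
      Finset.sum_lt_sum_of_nonempty hne fun e he => by
        have := Finset.mem_of_mem_erase he
        simpa [hS] using this
    have h3 : ∑ e ∈ S, v e ≤ 1 := by
      rw [← hv.1.2]
      exact Finset.sum_le_univ_sum_of_nonneg hv.1.1
    rw [← Finset.add_sum_erase S v he₀S, he₀] at h3
    rw [Finset.sum_const, nsmul_eq_mul] at h2
    nlinarith
  obtain ⟨A, hA⟩ := exists_allocation_load_le (κ := Fin n) v α hα.le hv.le S 1 (by simpa using hcard)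
  refine MMS_le_of_partial hv.1 _ S A (fun j => (hA j).trans (by push_cast; linarith)) ?_
  intro e he f hf hs
  by_contra! hc
  have hes : v e ≤ 2 / 3 * α := by simpa [hS] using he
  have h1 : α ≤ f (A e₀) := by
    refine le_trans ?_ (hf (A e₀))
    rw [← he₀]
    exact Finset.single_le_sum (f := v) (fun x _ => hv.1.1 x) (by simp [he₀S])
  have h2 : ((univ.erase (A e₀)).card : ℝ) * (4 / 3 * α - v e) < ∑ j ∈ univ.erase (A e₀), f j := by
    rw [← nsmul_eq_mul, ← Finset.sum_const]
    refine Finset.sum_lt_sum_of_nonempty ?_ fun j _ => by linarith [hc j]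
    rw [← Finset.card_pos, Finset.card_erase_of_mem (Finset.mem_univ _), Finset.card_univ,
      Fintype.card_fin]
    omega
  rw [Finset.card_erase_of_mem (Finset.mem_univ _), Finset.card_univ, Fintype.card_fin,
    Nat.cast_sub (by omega), Nat.cast_one] at h2
  rw [← Finset.add_sum_erase univ f (Finset.mem_univ (A e₀))] at hs
  nlinarith

/-- Objects of value at most `1 / (3 * (n - 1))` can always be added greedily. -/
theorem MMS_le_of_allocation_large_objects {n m : ℕ} [NeZero n] (hn : 2 ≤ n) {v : Fin m → ℝ}
    (hv : IsDisutility m v) (A : Fin m → Fin n)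
    (hA : ∀ j, load v (univ.filter fun e => 1 < 3 * ((n : ℝ) - 1) * v e) A j
      ≤ 4 / 3 * (1 / (n : ℝ))) :
    MMS n m v ≤ 4 / 3 * (1 / (n : ℝ)) := by
  have hn' : (0 : ℝ) < n := by exact_mod_cast NeZero.pos n
  refine MMS_le_of_partial hv _ _ A hA fun e he f _ hs => ?_
  by_contra! hc
  have hes : 3 * ((n : ℝ) - 1) * v e ≤ 1 := by simpa using he
  have h1 : (n : ℝ) * (4 / 3 * (1 / (n : ℝ)) - v e) < ∑ j, f j := by
    have : ∑ _j : Fin n, (4 / 3 * (1 / (n : ℝ)) - v e) < ∑ j, f j :=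
      Finset.sum_lt_sum_of_nonempty Finset.univ_nonempty fun j _ => by linarith [hc j]
    rwa [Finset.sum_const, Finset.card_univ, Fintype.card_fin, nsmul_eq_mul] at this
  have h2 : (n : ℝ) * (4 / 3 * (1 / (n : ℝ))) = 4 / 3 := by field_simp
  nlinarith

theorem card_large_objects_lt {n m : ℕ} (hn : 2 ≤ n) {v : Fin m → ℝ} (hv : IsDisutility m v) :
    (univ.filter fun e => 1 < 3 * ((n : ℝ) - 1) * v e).card < 3 * (n - 1) := by
  set S : Finset (Fin m) := univ.filter fun e => 1 < 3 * ((n : ℝ) - 1) * v e with hS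
  have hn' : (2 : ℝ) ≤ n := by exact_mod_cast hn
  rcases S.eq_empty_or_nonempty with h | h
  · rw [h, Finset.card_empty]; omega
  have h1 : ∑ _e ∈ S, (1 : ℝ) < ∑ e ∈ S, 3 * ((n : ℝ) - 1) * v e :=
    Finset.sum_lt_sum_of_nonempty h fun e he => by simpa [hS] using he
  have h2 : ∑ e ∈ S, v e ≤ 1 := by
    rw [← hv.2]
    exact Finset.sum_le_univ_sum_of_nonneg hv.1
  rw [← Finset.mul_sum, Finset.sum_const, nsmul_eq_mul, mul_one] at h1
  have h3 : (S.card : ℝ) < ((3 * (n - 1) : ℕ) : ℝ) := by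
    push_cast [Nat.cast_sub (show 1 ≤ n by omega)]
    nlinarith
  exact_mod_cast h3

theorem MMS_le_of_small {n m k : ℕ} (hn : 2 ≤ n) {α : ℝ} (hα : 0 < α)
    {v : Fin m → ℝ} (hv : Vmem α m v) (hk : k * α ≤ 4 / 3 * (1 / (n : ℝ)))
    (hkn : 3 * (n - 1) ≤ k * n + 1) :
    MMS n m v ≤ 4 / 3 * (1 / (n : ℝ)) := by
  have : NeZero n := ⟨by omega⟩
  have hcard := card_large_objects_lt hn hv.1
  obtain ⟨A, hA⟩ := exists_allocation_load_le (κ := Fin n) v α hα.le hv.le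
    (univ.filter fun e => 1 < 3 * ((n : ℝ) - 1) * v e) k (by rw [Fintype.card_fin]; omega)
  exact MMS_le_of_allocation_large_objects hn hv.1 A fun j => (hA j).trans hk

theorem exists_three_smallest {ι : Type*} [DecidableEq ι] (v : ι → ℝ) (S : Finset ι)
    (hS : 3 ≤ S.card) :
    ∃ R ⊆ S, R.card = 3 ∧ ∃ c ∈ R, (∀ e ∈ R, v e ≤ v c) ∧ ∀ e ∈ S \ R, v c ≤ v e := by
  obtain ⟨a, haS, ha⟩ := S.exists_min_image v (Finset.card_pos.1 (by omega))
  have h1 := Finset.card_erase_of_mem haS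
  obtain ⟨b, hbS, hb⟩ := (S.erase a).exists_min_image v (Finset.card_pos.1 (by omega))
  have h2 := Finset.card_erase_of_mem hbS
  obtain ⟨c, hcS, hc⟩ := ((S.erase a).erase b).exists_min_image v (Finset.card_pos.1 (by omega))
  simp only [Finset.mem_erase] at hbS hcS hb hc
  refine ⟨{a, b, c}, ?_, ?_, c, by simp, ?_, ?_⟩
  · intro e he
    simp only [Finset.mem_insert, Finset.mem_singleton] at he
    rcases he with rfl | rfl | rfl
    exacts [haS, hbS.2, hcS.2.2]
  · exact Finset.card_eq_three.2 ⟨a, b, c, hbS.1.symm, hcS.2.1.symm, hcS.1.symm, rfl⟩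
  · intro e he
    simp only [Finset.mem_insert, Finset.mem_singleton] at he
    rcases he with rfl | rfl | rfl
    exacts [ha c hcS.2.2, hb c hcS.2, le_rfl]
  · intro e he
    simp only [Finset.mem_sdiff, Finset.mem_insert, Finset.mem_singleton, not_or] at he
    exact hc e ⟨he.2.2.1, he.2.1, he.1⟩

theorem MMS_five_le {m : ℕ} (hm : 1 ≤ m) {α : ℝ} {v : Fin m → ℝ} (hv : Vmem α m v)
    (h1 : 1 / 9 ≤ α) (h2 : α ≤ 2 / 15) : MMS 5 m v ≤ 4 / 3 * (1 / ((5 : ℕ) : ℝ)) := by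
  have hα : 0 < α := by linarith
  have hcard := card_large_objects_lt (n := 5) (by norm_num) hv.1
  suffices hA : ∃ A : Fin m → Fin 5,
      ∀ j, load v (univ.filter fun e => 1 < 3 * (((5 : ℕ) : ℝ) - 1) * v e) A j
        ≤ 4 / 3 * (1 / ((5 : ℕ) : ℝ)) by
    obtain ⟨A, hA⟩ := hA
    exact MMS_le_of_allocation_large_objects (by norm_num) hv.1 A hA
  obtain ⟨e₀, he₀⟩ := hv.exists_eq hm
  set S : Finset (Fin m) := univ.filter fun e => 1 < 3 * (((5 : ℕ) : ℝ) - 1) * v e with hS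
  have he₀S : e₀ ∈ S := by simp [hS, he₀]; linarith
  by_cases hc : S.card ≤ 10
  · obtain ⟨A, hA⟩ := exists_allocation_load_le (κ := Fin 5) v α hα.le hv.le S 2 (by simpa using hc)
    refine ⟨A, fun j => (hA j).trans ?_⟩
    push_cast; linarith
  have hc' : S.card = 11 := by omega
  obtain ⟨R, hRS, hR, c, hcR, hRc, hcS⟩ := exists_three_smallest v S (by omega)
  have hd : (S \ R).card = 8 := by rw [Finset.card_sdiff_of_subset hRS]; omega
  have hsum : ∑ e ∈ R, v e ≤ 4 / 15 := by
    by_contra! hlt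
    have hRle := Finset.sum_le_card_nsmul R v (v c) hRc
    rw [hR, nsmul_eq_mul] at hRle
    push_cast at hRle
    have htot : ∑ e ∈ S \ R, v e + ∑ e ∈ R, v e ≤ 1 := by
      rw [Finset.sum_sdiff hRS, ← hv.1.2]
      exact Finset.sum_le_univ_sum_of_nonneg hv.1.1
    by_cases he : e₀ ∈ R
    · have h3 := Finset.card_nsmul_le_sum (S \ R) v (v c) hcS
      rw [hd, nsmul_eq_mul] at h3
      push_cast at h3
      linarith [hRc e₀ he]
    · have he' : e₀ ∈ S \ R := Finset.mem_sdiff.2 ⟨he₀S, he⟩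
      have h3 := Finset.card_nsmul_le_sum ((S \ R).erase e₀) v (v c)
        fun e he => hcS e (Finset.mem_of_mem_erase he)
      rw [Finset.card_erase_of_mem he', hd, nsmul_eq_mul] at h3
      rw [← Finset.add_sum_erase _ v he', he₀] at htot
      push_cast at h3
      linarith
  obtain ⟨A, hA⟩ := exists_allocation_load_le (κ := Fin 4) v α hα.le hv.le (S \ R) 2
    (by rw [hd]; simp)
  refine ⟨fun e => if e ∈ R then 0 else (A e).succ, fun j => ?_⟩
  induction j using Fin.cases with
  | zero =>
    have : (S.filter fun e => (if e ∈ R then 0 else (A e).succ) = (0 : Fin 5)) = R := by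
      ext e
      by_cases he : e ∈ R
      · simp [he, hRS he]
      · simp [he]
    unfold load
    rw [this]
    exact hsum.trans (by norm_num)
  | succ i =>
    have : (S.filter fun e => (if e ∈ R then 0 else (A e).succ) = i.succ)
        = (S \ R).filter fun e => A e = i := by
      ext e
      by_cases he : e ∈ R
      · simp [he, (Fin.succ_ne_zero i).symm]
      · simp [he]
    unfold load
    rw [this]
    exact (hA i).trans (by push_cast; linarith)

theorem stmt19 (n m : ℕ) (hn : 3 ≤ n) (hm : 1 ≤ m) (α : ℝ) (hα0 : 0 < α) (hα1 : α ≤ 1)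
    (hmα : ⌈1/α⌉ ≤ (m : ℤ))
    (h : ∃ (v v' : Fin m → ℝ), Vmem α m v ∧ Vmem α m v' ∧
      (4/3) * MMS n m v' < MMS n m v) :
    (n = 3 → 2/9 < α ∧ α < 1/3) ∧
    (n = 4 → 1/6 < α ∧ α < 3/11) ∧
    (n = 5 → (4/45 < α ∧ α < 1/9) ∨ (2/15 < α ∧ α < 3/13)) ∧
    (6 ≤ n → 4/(9*(n:ℝ)) < α ∧ α < 3/(2*(n:ℝ)+3)) := by
  have : NeZero n := ⟨by omega⟩
  have hn' : (3 : ℝ) ≤ n := by exact_mod_cast hn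
  obtain ⟨v, v', hv, hv', hlt⟩ := h
  obtain ⟨e, he⟩ := hv'.exists_eq hm
  have hlowα : α ≤ MMS n m v' := he ▸ le_MMS_of_mem hv'.1.1 e
  have hlown : 1 / (n : ℝ) ≤ MMS n m v' := one_div_le_MMS hv'.1.2
  have hup : α < 3 / (2 * (n : ℝ) + 3) := by
    by_contra! hc
    linarith [MMS_le_of_large hn hα0 hm hv hc]
  have hsmall : ∀ k : ℕ, 3 * (n - 1) ≤ k * n + 1 → 4 / 3 * (1 / (n : ℝ)) < k * α := by
    intro k hk
    by_contra! hc
    linarith [MMS_le_of_small (by omega) hα0 hv hc hk]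
  refine ⟨?_, ?_, ?_, ?_⟩
  · rintro rfl
    have h2 := hsmall 2 (by norm_num)
    norm_num at h2 hup ⊢
    constructor <;> linarith
  · rintro rfl
    have h2 := hsmall 2 (by norm_num)
    norm_num at h2 hup ⊢
    constructor <;> linarith
  · rintro rfl
    have h3 := hsmall 3 (by norm_num)
    have h5 : α < 1 / 9 ∨ 2 / 15 < α := by
      by_contra! hc
      linarith [MMS_five_le hm hv hc.1 hc.2]
    norm_num at h3 hup
    rcases h5 with h5 | h5
    · exact Or.inl ⟨by linarith, h5⟩
    · exact Or.inr ⟨h5, by linarith⟩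
  · intro _
    have h3 := hsmall 3 (by omega)
    refine ⟨?_, hup⟩
    have h4 : 4 / (9 * (n : ℝ)) = 4 / 3 * (1 / (n : ℝ)) / 3 := by field_simp; norm_num
    rw [h4]
    push_cast at h3
    linarith
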